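/- For every spherical residue x and every ξ ∈ Cr(X), the residue ξ(x) (the projection proj_x(ξ) of ξ to x) coincides with the unique maximal spherical residue (for the containment order ≤) which contains x and belongs to the combinatorial sector Q(x,ξ). -/

import Mathlib

open Filter Topology

noncomputable section

variable {B : Type} {W : Type} [Group W] {M : CoxeterMatrix B}

/-- The subset `I` of the simple reflections is of *spherical type* if the standard
parabolic subgroup `W_I` it generates is finite. -/
def SphType (cs : CoxeterSystem M W) (I : Set B) : Prop :=
  ((Subgroup.closure (cs.simple '' I) : Subgroup W) : Set W).Finite

/-- A building of type `(W,S)`, in the chamber-system (`W`-metric) approach: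
a nonempty set of chambers with a Weyl-group-valued distance function `delta`. -/
structure Bldg (cs : CoxeterSystem M W) where
  Chamber : Type
  chamber_nonempty : Nonempty Chamber
  delta : Chamber → Chamber → W
  delta_eq_one_iff : ∀ C D, delta C D = 1 ↔ C = D
  delta_mem_pair : ∀ C D E (i : B), delta D E = cs.simple i →
    delta C E = delta C D * cs.simple i ∨ delta C E = delta C D
  delta_eq_of_length : ∀ C D E (i : B), delta D E = cs.simple i →
    cs.length (delta C D * cs.simple i) = cs.length (delta C D) + 1 →
    delta C E = delta C D * cs.simple i
  exists_delta : ∀ C D (i : B), ∃ E, delta D E = cs.simple i ∧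
    delta C E = delta C D * cs.simple i

namespace Bldg

variable {cs : CoxeterSystem M W} (X : Bldg cs)

instance : Nonempty X.Chamber := X.chamber_nonempty

instance : TopologicalSpace X.Chamber := ⊥
instance : DiscreteTopology X.Chamber := ⟨rfl⟩

/-- The gallery distance between two chambers. -/
def gdist (C D : X.Chamber) : ℕ := cs.length (X.delta C D)

/-- The `I`-residue of the chamber `C`. -/
def residue (I : Set B) (C : X.Chamber) : Set X.Chamber :=
  {D | X.delta C D ∈ Subgroup.closure (cs.simple '' I)}

/-- `R` is a spherical residue. -/
def IsSphResidue (R : Set X.Chamber) : Prop :=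
  ∃ (I : Set B) (C : X.Chamber), SphType cs I ∧ R = X.residue I C

/-- `R` is a panel, i.e. an `{s}`-residue. -/
def IsPanel (R : Set X.Chamber) : Prop :=
  ∃ (i : B) (C : X.Chamber), R = X.residue {i} C

/-- The set `Res(X)` of spherical residues of `X`. -/
def Res : Type := {R : Set X.Chamber // X.IsSphResidue R}

/-- The set of panels of `X`. -/
def Panel : Type := {R : Set X.Chamber // X.IsPanel R}

instance : Nonempty X.Res := by
  obtain ⟨C⟩ := X.chamber_nonempty
  exact ⟨⟨X.residue ∅ C, ∅, C, by simp [SphType], rfl⟩⟩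

instance : TopologicalSpace X.Res := ⊥
instance : DiscreteTopology X.Res := ⟨rfl⟩

/-- `R₁ ≤ R₂` : the spherical residue `R₂` contains `R₁`, i.e. `R₂ ⊆ R₁` as
sets of chambers. -/
def leRes (R₁ R₂ : X.Res) : Prop := R₂.1 ⊆ R₁.1

/-- The star `St(σ)` of a spherical residue. -/
def star (σ : X.Res) : Set X.Res := {τ | X.leRes σ τ}

/-- The gate (combinatorial projection) of the chamber `C` onto the residue `R` :
the unique chamber of `R` through which pass minimal galleries from `C` to any
chamber of `R`. -/
def gate (R : Set X.Chamber) (C : X.Chamber) : X.Chamber :=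
  Classical.epsilon fun D => D ∈ R ∧ ∀ E ∈ R, X.gdist C E = X.gdist C D + X.gdist D E

/-- The combinatorial projection of the residue `T` onto the residue `R`,
as a set of chambers. -/
def projSet (R T : Set X.Chamber) : Set X.Chamber := X.gate R '' T

/-- The combinatorial projection `proj_R(T)` of the spherical residue `T` onto
the spherical residue `R`, as a spherical residue. -/
def projRes (R T : X.Res) : X.Res :=
  Classical.epsilon fun U : X.Res => U.1 = X.projSet R.1 T.1

/-- The map `proj_r : Res(X) → ∏_σ St(σ)` underlying the maximal combinatorial
bordification. -/
def projr (R : X.Res) : X.Res → X.Res := fun σ => X.projRes σ R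

/-- The maximal combinatorial bordification `Cr(X)`: the closure of the image
of `proj_r`, each factor of the product being discrete. -/
def Cr : Set (X.Res → X.Res) := closure (Set.range X.projr)

/-- The map `proj_c : ch(X) → ∏_{σ panel} St(σ)` underlying the minimal
combinatorial bordification. -/
def projc (C : X.Chamber) : X.Panel → X.Chamber := fun σ => X.gate σ.1 C

/-- The minimal combinatorial bordification `Cc(X)`. -/
def Cc : Set (X.Panel → X.Chamber) := closure (Set.range X.projc)

/-- A set of spherical residues is closed if it contains, with any residue,
all residues that it contains (in the order `leRes`). -/
def ClosedResSet (𝓡 : Set X.Res) : Prop :=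
  ∀ R₁ R₂ : X.Res, X.leRes R₁ R₂ → R₂ ∈ 𝓡 → R₁ ∈ 𝓡

/-- A set of spherical residues is convex if it is closed and stable under
combinatorial projections. -/
def ConvexResSet (𝓡 : Set X.Res) : Prop :=
  X.ClosedResSet 𝓡 ∧ ∀ R₁ ∈ 𝓡, ∀ R₂ ∈ 𝓡, X.projRes R₁ R₂ ∈ 𝓡

/-- The closure of a set of spherical residues. -/
def resClosure (𝓡 : Set X.Res) : Set X.Res := ⋂₀ {𝓢 | X.ClosedResSet 𝓢 ∧ 𝓡 ⊆ 𝓢}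

/-- The convex hull of a set of spherical residues. -/
def convHull (𝓡 : Set X.Res) : Set X.Res := ⋂₀ {𝓢 | X.ConvexResSet 𝓢 ∧ 𝓡 ⊆ 𝓢}

/-- The convex hull `Conv(R₁,R₂)` of two spherical residues. -/
def conv2 (R₁ R₂ : X.Res) : Set X.Res := X.convHull {R₁, R₂}

/-- `α : W → ch(X)` is an apartment map: an isometric embedding of the Coxeter
complex. -/
def IsApartMap (α : W → X.Chamber) : Prop :=
  Function.Injective α ∧ ∀ v w : W, X.delta (α v) (α w) = v⁻¹ * w

/-- `A` is an apartment of `X`. -/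
def IsApartment (A : Set X.Chamber) : Prop :=
  ∃ α : W → X.Chamber, X.IsApartMap α ∧ A = Set.range α

/-- The residue `R` lies in the apartment `A`. -/
def LiesIn (R : X.Res) (A : Set X.Chamber) : Prop := (R.1 ∩ A).Nonempty

/-- `φ` is a root (half-apartment) of the apartment `A`. -/
def IsRootOf (A φ : Set X.Chamber) : Prop :=
  ∃ α : W → X.Chamber, X.IsApartMap α ∧ A = Set.range α ∧
    ∃ t : W, cs.IsReflection t ∧ φ = α '' {v : W | cs.length v < cs.length (t * v)}

/-- The residue `R` is contained in the root `φ` of the apartment `A`. -/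
def ContainedInRoot (R : X.Res) (A φ : Set X.Chamber) : Prop := R.1 ∩ A ⊆ φ

/-- `Φ_A(R₁,R₂)`: the set of roots of `A` containing `R₁` but not `R₂`. -/
def PhiSep (A : Set X.Chamber) (R₁ R₂ : X.Res) : Set (Set X.Chamber) :=
  {φ | X.IsRootOf A φ ∧ X.ContainedInRoot R₁ A φ ∧ ¬ X.ContainedInRoot R₂ A φ}

/-- A choice of apartment in which both `R₁` and `R₂` lie. -/
def chooseApt (R₁ R₂ : X.Res) : Set X.Chamber :=
  Classical.epsilon fun A : Set X.Chamber => X.IsApartment A ∧ X.LiesIn R₁ A ∧ X.LiesIn R₂ A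

/-- The root-distance between two spherical residues:
`d(R₁,R₂) = ½|Φ_A(R₁,R₂)| + ½|Φ_A(R₂,R₁)|` for an apartment `A` containing both. -/
def rootDist (R₁ R₂ : X.Res) : ℝ :=
  (((X.PhiSep (X.chooseApt R₁ R₂) R₁ R₂).ncard +
    (X.PhiSep (X.chooseApt R₁ R₂) R₂ R₁).ncard : ℕ) : ℝ) / 2

/-- The interval `[R₁,R₂]` determined by two spherical residues. -/
def interval (R₁ R₂ : X.Res) : Set X.Res :=
  {σ | X.rootDist R₁ R₂ = X.rootDist R₁ σ + X.rootDist σ R₂}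

/-- The retraction onto the apartment given by the apartment map `α`, centred at
the chamber `α 1`. -/
def retr (α : W → X.Chamber) (D : X.Chamber) : X.Chamber := α (X.delta (α 1) D)

/-- The retraction onto an apartment, acting on spherical residues: it maps the
`I`-residue of a chamber `D` to the `I`-residue of the retracted chamber. -/
def retrRes (α : W → X.Chamber) (R : X.Res) : X.Res :=
  Classical.epsilon fun T : X.Res =>
    ∃ (I : Set B) (D : X.Chamber), R.1 = X.residue I D ∧ T.1 = X.residue I (X.retr α D)

/-- The sequence `(R_n)` of spherical residues converges to `ξ` in the maximal
combinatorial bordification. -/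
def ConvSeq (ξ : X.Res → X.Res) (R : ℕ → X.Res) : Prop :=
  Tendsto (fun n => X.projr (R n)) atTop (nhds ξ)

/-- `Q(x, (R_n)) = ⋃_k ⋂_{n ≥ k} Conv(x, R_n)`. -/
def Qseq (x : X.Res) (R : ℕ → X.Res) : Set X.Res :=
  ⋃ k : ℕ, ⋂ n : ℕ, ⋂ _ : k ≤ n, X.conv2 x (R n)

/-- The combinatorial sector `Q(x,ξ)` based at `x` and pointing towards `ξ`. -/
def Qsector (x : X.Res) (ξ : X.Res → X.Res) : Set X.Res :=
  X.Qseq x (Classical.epsilon (X.ConvSeq ξ))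

/-- `Φ_A(ξ)`: the set of roots of the apartment `A` (with apartment map `α`) in
which every sequence of residues converging to `ξ`, retracted to `A`, eventually
lies. -/
def PhiXi (A : Set X.Chamber) (α : W → X.Chamber) (ξ : X.Res → X.Res) :
    Set (Set X.Chamber) :=
  {φ | X.IsRootOf A φ ∧ ∀ R : ℕ → X.Res, X.ConvSeq ξ R →
    ∃ N : ℕ, ∀ n > N, X.ContainedInRoot (X.retrRes α (R n)) A φ}

/-- `Φ_A(x)`: the set of roots of `A` containing the residue `x`. -/
def PhiRes (A : Set X.Chamber) (x : X.Res) : Set (Set X.Chamber) :=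
  {φ | X.IsRootOf A φ ∧ X.ContainedInRoot x A φ}

/-- The spherical residue `x` is a chamber (an `∅`-residue). -/
def IsChamberRes (x : X.Res) : Prop :=
  ∃ C : X.Chamber, x.1 = X.residue (∅ : Set B) C

/-- The automorphism group of the building: all permutations of the chambers
preserving the Weyl distance. -/
def autGroup : Subgroup (Equiv.Perm X.Chamber) where
  carrier := {g | ∀ C D : X.Chamber, X.delta (g C) (g D) = X.delta C D}
  one_mem' := by intro C D; simp
  mul_mem' := by
    intro a b ha hb C D
    simp only [Equiv.Perm.mul_apply]
    rw [ha, hb]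
  inv_mem' := by
    intro a ha C D
    have := ha (a⁻¹ C) (a⁻¹ D)
    simpa using this.symm

/-- `Aut(X)` as a type. -/
abbrev Aut : Type := ↥X.autGroup

/-- The topology of pointwise convergence on `Aut(X)` (the chamber set being
discrete). -/
instance : TopologicalSpace X.Aut :=
  TopologicalSpace.induced
    (fun g : X.Aut => ((g : Equiv.Perm X.Chamber) : X.Chamber → X.Chamber)) inferInstance

/-- The action of an automorphism on spherical residues. -/
def actRes (g : X.Aut) (R : X.Res) : X.Res :=
  Classical.epsilon fun T : X.Res => T.1 = (g : Equiv.Perm X.Chamber) '' R.1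

/-- The action of an automorphism on panels. -/
def actPanel (g : X.Aut) (σ : X.Panel) : X.Panel :=
  haveI : Nonempty X.Panel := ⟨σ⟩
  Classical.epsilon fun τ : X.Panel => τ.1 = (g : Equiv.Perm X.Chamber) '' σ.1

/-- The action of `Aut(X)` on the maximal combinatorial bordification:
`(g·f)(σ) = g·f(g⁻¹σ)`. -/
def actCr (g : X.Aut) (f : X.Res → X.Res) : X.Res → X.Res :=
  fun σ => X.actRes g (f (X.actRes g⁻¹ σ))

/-- The action of `Aut(X)` on the minimal combinatorial bordification. -/
def actCc (g : X.Aut) (f : X.Panel → X.Chamber) : X.Panel → X.Chamber :=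
  fun σ => (g : Equiv.Perm X.Chamber) (f (X.actPanel g⁻¹ σ))

/-- The building is locally finite: `S` is finite and panels are finite. -/
def LocallyFinite : Prop :=
  Finite B ∧ ∀ R : Set X.Chamber, X.IsPanel R → R.Finite

/-- The building is thick: every panel contains at least three chambers. -/
def Thick : Prop := ∀ R : Set X.Chamber, X.IsPanel R → 3 ≤ R.ncard

/-- The subgroup `G ≤ Aut(X)` acts strongly transitively: transitively on pairs
`(C, A)` of a chamber contained in an apartment. -/
def StronglyTransitive (G : Subgroup X.Aut) : Prop :=
  ∀ (C C' : X.Chamber) (A A' : Set X.Chamber),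
    X.IsApartment A → C ∈ A → X.IsApartment A' → C' ∈ A' →
    ∃ g ∈ G, (g : Equiv.Perm X.Chamber) C = C' ∧ (g : Equiv.Perm X.Chamber) '' A = A'

end Bldg

/-- A topological group is amenable if there is a left-invariant mean on the
space of bounded continuous real-valued functions on it. -/
def IsAmenableGroup (H : Type*) [Group H] [TopologicalSpace H] : Prop :=
  ∃ m : BoundedContinuousFunction H ℝ →ₗ[ℝ] ℝ,
    m 1 = 1 ∧ (∀ f : BoundedContinuousFunction H ℝ, (∀ x, 0 ≤ f x) → 0 ≤ m f) ∧
    ∀ (g : H) (f₁ f₂ : BoundedContinuousFunction H ℝ),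
      (∀ x, f₂ x = f₁ (g * x)) → m f₂ = m f₁

/-- A subset `K` of a topological group is topologically locally finite if every
finite subset of `K` generates a subgroup with compact closure. -/
def IsTLFSet {H : Type*} [Group H] [TopologicalSpace H] (K : Set H) : Prop :=
  ∀ s : Finset H, (s : Set H) ⊆ K →
    IsCompact (closure ((Subgroup.closure (s : Set H) : Subgroup H) : Set H))

/-- The space of closed subgroups of a topological group. -/
def ChabautySpace (H : Type*) [Group H] [TopologicalSpace H] : Type _ :=
  {K : Subgroup H // IsClosed (K : Set H)}

instance {H : Type*} [Group H] [TopologicalSpace H] : Nonempty (ChabautySpace H) :=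
  ⟨⟨⊤, by rw [Subgroup.coe_top]; exact isClosed_univ⟩⟩

/-- The Chabauty topology on the space of closed subgroups. -/
instance {H : Type*} [Group H] [TopologicalSpace H] : TopologicalSpace (ChabautySpace H) :=
  TopologicalSpace.generateFrom
    ({s | ∃ K : Set H, IsCompact K ∧ s = {L : ChabautySpace H | (L.1 : Set H) ∩ K = ∅}} ∪
     {s | ∃ U : Set H, IsOpen U ∧ s = {L : ChabautySpace H | ((L.1 : Set H) ∩ U).Nonempty}})

namespace Bldg

variable {cs : CoxeterSystem M W} (X : Bldg cs)

/-- The stabiliser in `G` of a spherical residue, as a set. -/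
def gstab (G : Subgroup X.Aut) (R : X.Res) : Set ↥G :=
  {g : ↥G | X.actRes (g : X.Aut) R = R}

/-- The stabiliser in `G` of a spherical residue, as a closed subgroup of `G`. -/
def gstabC (G : Subgroup X.Aut) (R : X.Res) : ChabautySpace ↥G :=
  Classical.epsilon fun L : ChabautySpace ↥G => (L.1 : Set ↥G) = X.gstab G R

/-- `D_ξ`: the union over `x ∈ Res(X)` of the pointwise fixators in `G` of the
combinatorial sectors `Q(x,ξ)`. -/
def gfixSector (G : Subgroup X.Aut) (ξ : X.Res → X.Res) : Set ↥G :=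
  {g : ↥G | ∃ x : X.Res, ∀ R ∈ X.Qsector x ξ, X.actRes (g : X.Aut) R = R}

/-- `D_ξ` as a closed subgroup of `G` (an element of the Chabauty space). -/
def DxiC (G : Subgroup X.Aut) (ξ : X.Res → X.Res) : ChabautySpace ↥G :=
  Classical.epsilon fun L : ChabautySpace ↥G => (L.1 : Set ↥G) = X.gfixSector G ξ

/-- The set of periodic elements of the stabiliser `G_ξ`. -/
def periodicStab (G : Subgroup X.Aut) (ξ : X.Res → X.Res) : Set ↥G :=
  {g : ↥G | X.actCr (g : X.Aut) ξ = ξ ∧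
    IsCompact (closure ((Subgroup.zpowers g : Subgroup ↥G) : Set ↥G))}

/-- The horofunction compactification of the chamber graph, with base point `y₀`. -/
def horoCh (y₀ : X.Chamber) : Set (X.Chamber → ℝ) :=
  closure (Set.range fun C : X.Chamber =>
    fun y : X.Chamber => (X.gdist C y : ℝ) - (X.gdist C y₀ : ℝ))

/-- The horofunction compactification of `(Res(X), root-distance)`, with base
point `z₀`. -/
def horoRes (z₀ : X.Res) : Set (X.Res → ℝ) :=
  closure (Set.range fun R : X.Res =>
    fun y : X.Res => X.rootDist R y - X.rootDist R z₀)

/-- The action of `Aut(X)` on horofunctions of the chamber graph. -/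
def actHoroCh (y₀ : X.Chamber) (g : X.Aut) (h : X.Chamber → ℝ) : X.Chamber → ℝ :=
  fun y => h (((g⁻¹ : X.Aut) : Equiv.Perm X.Chamber) y) -
    h (((g⁻¹ : X.Aut) : Equiv.Perm X.Chamber) y₀)

/-- The action of `Aut(X)` on horofunctions of `(Res(X), root-distance)`. -/
def actHoroRes (z₀ : X.Res) (g : X.Aut) (h : X.Res → ℝ) : X.Res → ℝ :=
  fun y => h (X.actRes g⁻¹ y) - h (X.actRes g⁻¹ z₀)

end Bldg

namespace CoxeterSystem

variable (cs : CoxeterSystem M W)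

open scoped Classical in
/-- The action of a simple reflection on `W × ZMod 2` by conjugation on the first factor,
flipping the sign at the simple reflection itself. -/
def signedConj (i : B) : Function.End (W × ZMod 2) := fun p =>
  (cs.simple i * p.1 * cs.simple i, p.2 + if p.1 = cs.simple i then 1 else 0)

open scoped Classical in
theorem signedConj_mul_pow (i j : B) (k : ℕ) (t : W) (e : ZMod 2) :
    ((cs.signedConj i * cs.signedConj j) ^ k) (t, e) =
      ((cs.simple i * cs.simple j) ^ k * t * ((cs.simple i * cs.simple j) ^ k)⁻¹,
        e + ∑ a ∈ Finset.range (2 * k),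
          if t = (cs.simple j * cs.simple i) ^ a * cs.simple j then (1 : ZMod 2) else 0) := by
  induction k with
  | zero => simp; rfl
  | succ k ih =>
    rw [pow_succ']
    change cs.signedConj i (cs.signedConj j (((cs.signedConj i * cs.signedConj j) ^ k) (t, e))) = _
    rw [ih]
    have hinv : (cs.simple i * cs.simple j)⁻¹ = cs.simple j * cs.simple i := by simp
    have hcomm : ∀ n : ℕ, cs.simple j * (cs.simple i * cs.simple j) ^ n =
        (cs.simple j * cs.simple i) ^ n * cs.simple j := fun n => by
      induction n with
      | zero => simp
      | succ n ihn => rw [pow_succ, ← mul_assoc, ihn, pow_succ]; simp only [mul_assoc]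
    have hpow : ((cs.simple i * cs.simple j) ^ k)⁻¹ = (cs.simple j * cs.simple i) ^ k := by
      rw [← inv_pow, hinv]
    have h1 : ∀ y : W, (cs.simple i * cs.simple j) ^ k * t * ((cs.simple i * cs.simple j) ^ k)⁻¹ = y
        ↔ t = (cs.simple j * cs.simple i) ^ k * y * (cs.simple i * cs.simple j) ^ k := fun y => by
      rw [← hpow]
      constructor
      · rintro rfl; group
      · intro h; rw [h]; group
    have h2 : (cs.simple j * cs.simple i) ^ k * cs.simple j * (cs.simple i * cs.simple j) ^ k =
        (cs.simple j * cs.simple i) ^ (2 * k) * cs.simple j := by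
      rw [mul_assoc, hcomm, two_mul, pow_add, mul_assoc]
    have h3 : (cs.simple j * cs.simple i) ^ k * (cs.simple j * cs.simple i * cs.simple j) *
        (cs.simple i * cs.simple j) ^ k =
        (cs.simple j * cs.simple i) ^ (2 * k + 1) * cs.simple j := by
      rw [mul_assoc, mul_assoc (cs.simple j * cs.simple i), hcomm, ← mul_assoc (cs.simple j * _),
        ← pow_succ', ← mul_assoc, ← pow_add]
      congr 2; omega
    have h4 : ∀ y : W, cs.simple j * y * cs.simple j = cs.simple i ↔
        y = cs.simple j * cs.simple i * cs.simple j := fun y => by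
      constructor
      · intro h; rw [← h]; simp [mul_assoc]
      · rintro rfl; simp [mul_assoc]
    simp only [signedConj, h4, h1, h2, h3]
    rw [show 2 * (k + 1) = 2 * k + 1 + 1 by ring, Finset.sum_range_succ, Finset.sum_range_succ,
      pow_succ' (cs.simple i * cs.simple j), mul_inv_rev, hinv]
    ext
    · simp only [mul_assoc]
    · simp only [add_assoc]

theorem isLiftable_signedConj : M.IsLiftable cs.signedConj := by
  classical
  intro i j
  funext ⟨t, e⟩
  rw [signedConj_mul_pow]
  have hm : (cs.simple j * cs.simple i) ^ M i j = 1 := by simp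
  rw [two_mul, Finset.sum_range_add]
  simp only [pow_add, hm, one_mul, simple_mul_simple_pow, mul_one, inv_one]
  rw [CharTwo.add_self_eq_zero, add_zero]
  rfl

/-- The parity of the number of occurrences of `t` in the left inversion sequence of any word
representing `w`. -/
def invParity (w t : W) : ZMod 2 := (cs.lift ⟨_, cs.isLiftable_signedConj⟩ w⁻¹ (t, 0)).2

theorem lift_signedConj (w t : W) (e : ZMod 2) :
    cs.lift ⟨_, cs.isLiftable_signedConj⟩ w (t, e) =
      (w * t * w⁻¹, e + cs.invParity w⁻¹ t) := by
  simp only [invParity, inv_inv]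
  induction w using cs.simple_induction_left generalizing t e with
  | one =>
    simp only [inv_one, map_one, one_mul, mul_one]
    change (t, e) = (t, e + 0)
    rw [add_zero]
  | mul_simple_left w i ih =>
    rw [map_mul, lift_apply_simple]
    change cs.signedConj i _ = (_, e + (cs.signedConj i _).2)
    rw [ih t e, ih t 0]
    simp [signedConj, mul_assoc, add_assoc]

theorem invParity_mul (g h t : W) :
    cs.invParity (g * h) t = cs.invParity g t + cs.invParity h (g⁻¹ * t * g) := by
  conv_lhs => rw [invParity, mul_inv_rev, map_mul]
  change (cs.lift ⟨_, cs.isLiftable_signedConj⟩ h⁻¹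
    (cs.lift ⟨_, cs.isLiftable_signedConj⟩ g⁻¹ (t, 0))).2 = _
  rw [lift_signedConj, lift_signedConj]
  simp

open scoped Classical in
theorem invParity_simple (i : B) (t : W) :
    cs.invParity (cs.simple i) t = if t = cs.simple i then 1 else 0 := by
  rw [invParity, inv_simple, lift_apply_simple]
  simp [signedConj]

theorem invParity_one (t : W) : cs.invParity 1 t = 0 := by
  have := cs.invParity_mul 1 1 t
  simpa using this

theorem invParity_inv (w t : W) : cs.invParity w⁻¹ t = cs.invParity w (w * t * w⁻¹) := by
  have := cs.invParity_mul w⁻¹ w t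
  rw [inv_mul_cancel, invParity_one, inv_inv] at this
  exact CharTwo.add_eq_zero.mp this.symm

theorem invParity_self {t : W} (ht : cs.IsReflection t) : cs.invParity t t = 1 := by
  obtain ⟨w, i, rfl⟩ := ht
  rw [invParity_mul, invParity_mul, invParity_simple, invParity_inv]
  have h1 : w⁻¹ * (w * cs.simple i * w⁻¹) * w = cs.simple i := by group
  have h2 : w * ((w * cs.simple i)⁻¹ * (w * cs.simple i * w⁻¹) * (w * cs.simple i)) * w⁻¹ =
      w * cs.simple i * w⁻¹ := by group
  rw [h1, h2, if_pos rfl, add_right_comm, CharTwo.add_self_eq_zero, zero_add]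

theorem mem_leftInvSeq_of_invParity (ω : List B) (t : W)
    (h : cs.invParity (cs.wordProd ω) t = 1) : t ∈ cs.leftInvSeq ω := by
  induction ω generalizing t with
  | nil => simp [invParity_one] at h
  | cons i ω ih =>
    rw [wordProd_cons, invParity_mul, invParity_simple] at h
    by_cases hti : t = cs.simple i
    · simp [leftInvSeq, hti]
    · rw [if_neg hti, zero_add] at h
      simp only [leftInvSeq, List.mem_cons, List.mem_map]
      exact Or.inr ⟨_, ih _ h, by simp [mul_assoc]⟩

theorem invParity_eq_one_iff (w t : W) : cs.invParity w t = 1 ↔ cs.IsLeftInversion w t := by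
  have key : ∀ w, cs.invParity w t = 1 → cs.IsLeftInversion w t := fun w h => by
    obtain ⟨ω, hω, rfl⟩ := cs.exists_isReduced w
    exact cs.isLeftInversion_of_mem_leftInvSeq hω (cs.mem_leftInvSeq_of_invParity ω t h)
  refine ⟨key w, fun ⟨ht, hlt⟩ => ?_⟩
  by_contra hne
  have h0 : cs.invParity w t = 0 := by
    revert hne; generalize cs.invParity w t = a; revert a; decide
  have := (key (t * w) (by
    rw [invParity_mul, cs.invParity_self ht]
    rw [show t⁻¹ * t * t = t by group, h0, add_zero])).2
  rw [← mul_assoc, ht.mul_self, one_mul] at this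
  omega

theorem invParity_eq_zero_or_one (w t : W) : cs.invParity w t = 0 ∨ cs.invParity w t = 1 := by
  generalize cs.invParity w t = a; revert a; decide

theorem not_isLeftInversion_of_length_mul {g h : W}
    (hgh : cs.length (g * h) = cs.length g + cs.length h) {t : W}
    (ht : cs.invParity g t = 1) : cs.invParity h (g⁻¹ * t * g) = 0 := by
  refine (cs.invParity_eq_zero_or_one _ _).resolve_right fun h1 => ?_
  have ht' := (cs.invParity_eq_one_iff _ _).1 ht
  have h2 := ((cs.invParity_eq_one_iff _ _).1 h1).2
  have h3 := cs.length_mul_le (t * g) (g⁻¹ * t * g * h)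
  have h4 : t * g * (g⁻¹ * t * g * h) = g * h := by
    have := ht'.1.mul_self
    calc _ = (t * t) * g * h := by group
      _ = _ := by rw [this, one_mul]
  rw [h4] at h3
  have := ht'.2
  omega

theorem length_mul_of_forall_invParity {g h : W}
    (H : ∀ t, cs.invParity g t = 1 → cs.invParity h (g⁻¹ * t * g) = 0) :
    cs.length (g * h) = cs.length g + cs.length h := by
  induction hn : cs.length h generalizing h with
  | zero => rw [cs.length_eq_zero_iff] at hn; simp [hn]
  | succ n ih =>
    obtain ⟨i, hi⟩ := cs.exists_rightDescent_of_ne_one (w := h)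
      (by rintro rfl; simp at hn)
    obtain ⟨h', rfl⟩ : ∃ h', h = h' * cs.simple i := ⟨h * cs.simple i, by simp⟩
    rw [isRightDescent_iff, simple_mul_simple_cancel_right] at hi
    have hpar : ∀ r, cs.invParity (h' * cs.simple i) r =
        cs.invParity h' r + cs.invParity (cs.simple i) (h'⁻¹ * r * h') :=
      fun r => cs.invParity_mul _ _ _
    have hself : cs.invParity h' (h' * cs.simple i * h'⁻¹) = 0 := by
      refine (cs.invParity_eq_zero_or_one _ _).resolve_right fun h1 => ?_
      have := ((cs.invParity_eq_one_iff _ _).1 h1).2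
      rw [inv_mul_cancel_right] at this
      omega
    have hgh' : cs.length (g * h') = cs.length g + n := by
      refine ih (fun t ht => ?_) (by omega)
      have h1 := H t ht
      refine (cs.invParity_eq_zero_or_one _ _).resolve_right fun h2 => ?_
      rw [hpar, h2, invParity_simple] at h1
      split_ifs at h1 with h3
      · rw [← h3, show h' * (h'⁻¹ * (g⁻¹ * t * g) * h') * h'⁻¹ = g⁻¹ * t * g by group, h2] at hself
        exact one_ne_zero hself
      · simp at h1
    rw [← mul_assoc]
    rcases cs.length_mul_simple (g * h') i with h1 | h1
    · omega
    · exfalso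
      have h2 : cs.invParity (g * h') (g * h' * cs.simple i * (g * h')⁻¹) = 1 := by
        rw [invParity_eq_one_iff]
        refine ⟨⟨_, _, rfl⟩, ?_⟩
        rw [inv_mul_cancel_right]
        omega
      have h3 : g⁻¹ * (g * h' * cs.simple i * (g * h')⁻¹) * g = h' * cs.simple i * h'⁻¹ := by group
      rw [invParity_mul, h3, hself, add_zero] at h2
      have h4 := H _ h2
      rw [h3, hpar, hself, invParity_simple, if_pos (by group), zero_add] at h4
      exact one_ne_zero h4

theorem weak_order_interval_convex {u v w z : W}
    (hu : cs.length u + cs.length (u⁻¹ * w) = cs.length w)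
    (hv : cs.length v + cs.length (v⁻¹ * w) = cs.length w)
    (hz : cs.length (u⁻¹ * z) + cs.length (z⁻¹ * v) = cs.length (u⁻¹ * v)) :
    cs.length z + cs.length (z⁻¹ * w) = cs.length w := by
  have hmono : ∀ a : W, cs.length a + cs.length (a⁻¹ * w) = cs.length w →
      ∀ t, cs.invParity a t = 1 → cs.invParity w t = 1 := fun a ha t ht => by
    have h1 : a * (a⁻¹ * w) = w := by group
    have := cs.not_isLeftInversion_of_length_mul (g := a) (h := a⁻¹ * w) (by rw [h1, ha]) ht
    rw [← h1, invParity_mul, ht, this, add_zero]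
  have hsub : ∀ t, cs.invParity z t = 1 → cs.invParity w t = 1 := fun t ht => by
    rcases cs.invParity_eq_zero_or_one u t with h1 | h1
    · rcases cs.invParity_eq_zero_or_one v t with h2 | h2
      · exfalso
        have h3 := cs.invParity_mul u (u⁻¹ * z) t
        have h4 := cs.invParity_mul z (z⁻¹ * v) t
        rw [mul_inv_cancel_left, ht, h1, zero_add] at h3
        rw [mul_inv_cancel_left, ht, h2] at h4
        have h5 := cs.not_isLeftInversion_of_length_mul (g := u⁻¹ * z) (h := z⁻¹ * v)
          (by rw [hz]; congr 1; group) h3.symm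
        rw [show (u⁻¹ * z)⁻¹ * (u⁻¹ * t * u) * (u⁻¹ * z) = z⁻¹ * t * z by group] at h5
        rw [h5, add_zero] at h4
        exact zero_ne_one h4
      · exact hmono v hv t h2
    · exact hmono u hu t h1
  have := cs.length_mul_of_forall_invParity (g := z) (h := z⁻¹ * w) fun t ht => by
    have h1 := cs.invParity_mul z (z⁻¹ * w) t
    rw [mul_inv_cancel_left, ht, hsub t ht] at h1
    simpa using h1
  rw [← this, mul_inv_cancel_left]

/-- The standard parabolic subgroup of type `I`. -/
abbrev parabolic (I : Set B) : Subgroup W := Subgroup.closure (cs.simple '' I)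

theorem mem_parabolic_of_invParity {I : Set B} {v t : W} (hv : v ∈ cs.parabolic I)
    (ht : cs.invParity v t = 1) : t ∈ cs.parabolic I := by
  induction hv using Subgroup.closure_induction generalizing t with
  | mem x hx =>
    obtain ⟨i, hi, rfl⟩ := hx
    rw [invParity_simple] at ht
    split_ifs at ht with h
    · exact h ▸ Subgroup.subset_closure ⟨i, hi, rfl⟩
    · simp at ht
  | one => simp [invParity_one] at ht
  | mul x y hx hy ihx ihy =>
    rw [invParity_mul] at ht
    rcases cs.invParity_eq_zero_or_one x t with h | h
    · rw [h, zero_add] at ht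
      have := mul_mem (mul_mem hx (ihy ht)) (inv_mem hx)
      rwa [show x * (x⁻¹ * t * x) * x⁻¹ = t by group] at this
    · exact ihx h
  | inv x hx ih =>
    rw [invParity_inv] at ht
    have := mul_mem (mul_mem (inv_mem hx) (ih ht)) hx
    rwa [show x⁻¹ * (x * t * x⁻¹) * x = t by group] at this

theorem simple_mem_parabolic_of_isLeftDescent {I : Set B} {v : W} (hv : v ∈ cs.parabolic I)
    {i : B} (hi : cs.IsLeftDescent v i) : cs.simple i ∈ cs.parabolic I :=
  cs.mem_parabolic_of_invParity hv <| (cs.invParity_eq_one_iff _ _).2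
    ((cs.isLeftInversion_simple_iff_isLeftDescent _ _).2 hi)

theorem simple_mem_parabolic_of_isRightDescent {I : Set B} {v : W} (hv : v ∈ cs.parabolic I)
    {i : B} (hi : cs.IsRightDescent v i) : cs.simple i ∈ cs.parabolic I :=
  cs.simple_mem_parabolic_of_isLeftDescent (inv_mem hv) (cs.isLeftDescent_inv_iff.2 hi)

theorem length_mul_of_minimal {I : Set B} {w : W}
    (hw : ∀ v ∈ cs.parabolic I, cs.length w ≤ cs.length (w * v)) {v : W}
    (hv : v ∈ cs.parabolic I) : cs.length (w * v) = cs.length w + cs.length v := by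
  refine cs.length_mul_of_forall_invParity fun t ht => ?_
  refine (cs.invParity_eq_zero_or_one _ _).resolve_right fun h1 => ?_
  have h2 := hw _ (cs.mem_parabolic_of_invParity hv h1)
  rw [show w * (w⁻¹ * t * w) = t * w by group] at h2
  have := ((cs.invParity_eq_one_iff _ _).1 ht).2
  omega

/-- The simple reflections in `W_I ∩ w W_J w⁻¹`. -/
def interType (I J : Set B) (w : W) : Set B :=
  {i | cs.simple i ∈ cs.parabolic I ∧ w⁻¹ * cs.simple i * w ∈ cs.parabolic J}

theorem parabolic_interType_le (I J : Set B) (w : W) :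
    cs.parabolic (cs.interType I J w) ≤ cs.parabolic I := by
  rw [Subgroup.closure_le]
  rintro _ ⟨i, hi, rfl⟩
  exact hi.1

theorem conj_mem_of_mem_interType {I J : Set B} {w v : W}
    (hv : v ∈ cs.parabolic (cs.interType I J w)) : w⁻¹ * v * w ∈ cs.parabolic J := by
  have : cs.parabolic (cs.interType I J w) ≤ (cs.parabolic J).comap (MulAut.conj w⁻¹).toMonoidHom := by
    rw [Subgroup.closure_le]
    rintro _ ⟨i, hi, rfl⟩
    simpa using hi.2
  simpa using this hv

theorem mem_parabolic_interType {I J : Set B} {w : W}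
    (hw : ∀ v ∈ cs.parabolic I, cs.length (v * w) = cs.length v + cs.length w)
    {v u j : W} (hv : v ∈ cs.parabolic I) (hj : j ∈ cs.parabolic J) (h : v * u = w * j)
    (hvu : cs.length (v * u) = cs.length v + cs.length u) :
    v ∈ cs.parabolic (cs.interType I J w) := by
  induction hn : cs.length v generalizing v j with
  | zero => rw [cs.length_eq_zero_iff] at hn; exact hn ▸ one_mem _
  | succ n ih =>
    obtain ⟨i, hi⟩ := cs.exists_leftDescent_of_ne_one (w := v) (by rintro rfl; simp at hn)
    have hiI := cs.simple_mem_parabolic_of_isLeftDescent hv hi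
    rw [isLeftDescent_iff] at hi
    have hle := cs.length_mul_le (cs.simple i * v) u
    have hge : cs.length (v * u) ≤ cs.length (cs.simple i * v * u) + 1 := by
      have := cs.length_mul_le (cs.simple i) (cs.simple i * v * u)
      rw [mul_assoc, simple_mul_simple_cancel_left, length_simple] at this
      rw [mul_assoc]; omega
    have h1 : cs.invParity (w * j) (cs.simple i) = 1 := by
      rw [← h, invParity_eq_one_iff]
      refine ⟨cs.isReflection_simple i, ?_⟩
      rw [← mul_assoc]; omega
    have h2 : cs.invParity w (cs.simple i) = 0 := by
      refine (cs.invParity_eq_zero_or_one _ _).resolve_right fun h3 => ?_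
      have h4 := ((cs.invParity_eq_one_iff _ _).1 h3).2
      rw [hw _ hiI] at h4
      omega
    rw [invParity_mul, h2, zero_add] at h1
    have h3 := cs.mem_parabolic_of_invParity hj h1
    have h4 : cs.simple i ∈ cs.parabolic (cs.interType I J w) :=
      Subgroup.subset_closure ⟨i, ⟨hiI, h3⟩, rfl⟩
    have h5 := ih (v := cs.simple i * v) (j := w⁻¹ * cs.simple i * w * j) (mul_mem hiI hv)
      (mul_mem h3 hj) (by rw [mul_assoc, h]; group) (by omega) (by omega)
    have := mul_mem h4 h5
    rwa [simple_mul_simple_cancel_left] at this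

end CoxeterSystem

namespace Bldg

variable {cs : CoxeterSystem M W} (X : Bldg cs)

theorem delta_self (C : X.Chamber) : X.delta C C = 1 := (X.delta_eq_one_iff C C).2 rfl

theorem delta_simple_symm {C D : X.Chamber} {i : B} (h : X.delta C D = cs.simple i) :
    X.delta D C = cs.simple i := by
  obtain ⟨E, h1, h2⟩ := X.exists_delta C D i
  rw [h, cs.simple_mul_simple_self, X.delta_eq_one_iff] at h2
  exact h2 ▸ h1

/-- There is a gallery of type `ω` from `C` to `D`. -/
def Gallery : List B → X.Chamber → X.Chamber → Prop
  | [], C, D => C = D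
  | i :: ω, C, D => ∃ E, X.delta C E = cs.simple i ∧ Gallery ω E D

variable {X}

theorem Gallery.append {ω ω' : List B} {C D E : X.Chamber} (h : X.Gallery ω C D)
    (h' : X.Gallery ω' D E) : X.Gallery (ω ++ ω') C E := by
  induction ω generalizing C with
  | nil => exact (show C = D from h) ▸ h'
  | cons i ω ih =>
    obtain ⟨F, h1, h2⟩ := h
    exact ⟨F, h1, ih h2⟩

theorem Gallery.reverse {ω : List B} {C D : X.Chamber} (h : X.Gallery ω C D) :
    X.Gallery ω.reverse D C := by
  induction ω generalizing C with
  | nil => exact Eq.symm h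
  | cons i ω ih =>
    obtain ⟨F, h1, h2⟩ := h
    rw [List.reverse_cons]
    exact (ih h2).append ⟨C, X.delta_simple_symm h1, rfl⟩

theorem Gallery.delta_eq {ω : List B} {A C D : X.Chamber} (h : X.Gallery ω C D)
    (hl : cs.length (X.delta A C * cs.wordProd ω) = cs.length (X.delta A C) + ω.length) :
    X.delta A D = X.delta A C * cs.wordProd ω := by
  induction ω generalizing C with
  | nil => simp [(show C = D from h)]
  | cons i ω ih =>
    obtain ⟨F, h1, h2⟩ := h
    rw [cs.wordProd_cons, ← mul_assoc, List.length_cons] at hl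
    have h3 := cs.length_mul_le (X.delta A C * cs.simple i) (cs.wordProd ω)
    have h4 := cs.length_wordProd_le ω
    have h5 := cs.length_mul_simple (X.delta A C) i
    have h6 := X.delta_eq_of_length A C F i h1 (by omega)
    rw [cs.wordProd_cons, ← mul_assoc, ← h6]
    rw [← h6] at hl h3 h5
    exact ih h2 (by omega)

theorem Gallery.length_delta_le {ω : List B} {A C D : X.Chamber} (h : X.Gallery ω C D) :
    cs.length (X.delta A D) ≤ cs.length (X.delta A C) + ω.length := by
  induction ω generalizing C with
  | nil => simp [(show C = D from h)]
  | cons i ω ih =>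
    obtain ⟨F, h1, h2⟩ := h
    have h3 := ih h2
    have h4 : cs.length (X.delta A F) ≤ cs.length (X.delta A C) + 1 := by
      have := cs.length_mul_simple (X.delta A C) i
      rcases X.delta_mem_pair A C F i h1 with h | h <;> rw [h] <;> omega
    rw [List.length_cons]; omega

variable (X)

theorem exists_gallery (ω : List B) (u : W) {C D : X.Chamber}
    (h : X.delta C D = u * cs.wordProd ω) :
    ∃ E, X.delta C E = u ∧ X.Gallery ω E D := by
  induction ω generalizing u with
  | nil => exact ⟨D, by simpa using h, rfl⟩
  | cons i ω ih =>
    obtain ⟨E, h1, h2⟩ := ih (u * cs.simple i) (by rw [h, cs.wordProd_cons, mul_assoc])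
    obtain ⟨F, h3, h4⟩ := X.exists_delta C E i
    rw [h1, cs.simple_mul_simple_cancel_right] at h4
    exact ⟨F, h4, E, X.delta_simple_symm h3, h2⟩

theorem exists_reduced_gallery (C D : X.Chamber) :
    ∃ ω, cs.IsReduced ω ∧ X.delta C D = cs.wordProd ω ∧ X.Gallery ω C D := by
  obtain ⟨ω, h1, h2⟩ := cs.exists_isReduced (X.delta C D)
  obtain ⟨E, h3, h4⟩ := X.exists_gallery ω 1 (C := C) (D := D) (by rw [h2, one_mul])
  rw [X.delta_eq_one_iff] at h3
  exact ⟨ω, h1, h2, h3 ▸ h4⟩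

theorem delta_symm (C D : X.Chamber) : X.delta D C = (X.delta C D)⁻¹ := by
  obtain ⟨ω, h1, h2, h3⟩ := X.exists_reduced_gallery C D
  have := h3.reverse.delta_eq (A := D) (by
    rw [delta_self, one_mul, cs.length_one, zero_add]; exact h1.reverse)
  rw [this, delta_self, one_mul, h2, cs.wordProd_reverse]

theorem gdist_symm (C D : X.Chamber) : X.gdist D C = X.gdist C D := by
  rw [gdist, delta_symm, cs.length_inv, gdist]

theorem gdist_eq_zero {C D : X.Chamber} : X.gdist C D = 0 ↔ C = D := by
  rw [gdist, cs.length_eq_zero_iff, X.delta_eq_one_iff]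

theorem gdist_triangle (A C D : X.Chamber) : X.gdist A D ≤ X.gdist A C + X.gdist C D := by
  obtain ⟨ω, h1, h2, h3⟩ := X.exists_reduced_gallery C D
  have := h3.length_delta_le (A := A)
  rwa [← h1.eq, ← h2] at this

theorem delta_mul_of_length {A C D : X.Chamber}
    (h : cs.length (X.delta A C * X.delta C D) = X.gdist A C + X.gdist C D) :
    X.delta A D = X.delta A C * X.delta C D := by
  obtain ⟨ω, h1, h2, h3⟩ := X.exists_reduced_gallery C D
  rw [gdist, gdist, h2, h1.eq] at h
  rw [h3.delta_eq h, h2]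

theorem delta_mul_of_gdist {A C D : X.Chamber}
    (h : X.gdist A C + X.gdist C D = X.gdist A D) :
    X.delta A C * X.delta C D = X.delta A D := by
  obtain ⟨ω, h1, h2, h3⟩ := X.exists_reduced_gallery C D
  rw [gdist, gdist, h2, h1.eq] at h
  rw [h2]
  clear h1 h2
  induction ω generalizing C with
  | nil => simp [(show C = D from h3)]
  | cons i ω ih =>
    obtain ⟨F, h4, h5⟩ := h3
    have h6 := h5.length_delta_le (A := A)
    have h7 := cs.length_mul_simple (X.delta A C) i
    rw [List.length_cons, gdist] at h
    rcases X.delta_mem_pair A C F i h4 with h8 | h8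
    · rw [cs.wordProd_cons, ← mul_assoc, ← h8]
      rw [← h8] at h7
      refine ih ?_ h5
      rw [gdist]; omega
    · rw [h8] at h6; omega

/-- The combinatorial interval between two chambers. -/
def chInterval (C D : X.Chamber) : Set X.Chamber :=
  {E | X.gdist C E + X.gdist E D = X.gdist C D}

variable {X}

theorem delta_of_mem_chInterval {C D E : X.Chamber} (h : E ∈ X.chInterval C D) :
    X.delta E D = (X.delta C E)⁻¹ * X.delta C D := by
  rw [← X.delta_mul_of_gdist h, inv_mul_cancel_left]

theorem length_of_mem_chInterval {C D E : X.Chamber} (h : E ∈ X.chInterval C D) :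
    cs.length (X.delta C E) + cs.length ((X.delta C E)⁻¹ * X.delta C D) =
      cs.length (X.delta C D) := by
  rw [← delta_of_mem_chInterval h]; exact h

theorem exists_mem_chInterval {C D : X.Chamber} {z : W}
    (h : cs.length z + cs.length (z⁻¹ * X.delta C D) = cs.length (X.delta C D)) :
    ∃ E ∈ X.chInterval C D, X.delta C E = z := by
  obtain ⟨ω, h1, h2⟩ := cs.exists_isReduced (z⁻¹ * X.delta C D)
  obtain ⟨E, h3, h4⟩ := X.exists_gallery ω z (C := C) (D := D) (by rw [← h2, mul_inv_cancel_left])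
  refine ⟨E, ?_, h3⟩
  have h5 := h4.length_delta_le (A := E)
  have h6 := X.gdist_triangle C E D
  rw [delta_self, cs.length_one, zero_add, ← h1.eq, ← h2] at h5
  change X.gdist C E + X.gdist E D = X.gdist C D
  simp only [gdist, h3] at *
  omega

theorem eq_of_mem_chInterval {C D E E' : X.Chamber} (h : E ∈ X.chInterval C D)
    (h' : E' ∈ X.chInterval C D) (he : X.delta C E = X.delta C E') : E = E' := by
  induction hn : X.gdist E D generalizing D with
  | zero =>
    have h1 : X.gdist E' D = 0 := by
      rw [gdist, delta_of_mem_chInterval h', ← he, ← delta_of_mem_chInterval h]; exact hn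
    rw [gdist_eq_zero] at hn h1
    rw [hn, h1]
  | succ n ih =>
    have hv : X.delta E D ≠ 1 := by
      intro h1; rw [gdist, h1, cs.length_one] at hn; omega
    obtain ⟨i, hi⟩ := cs.exists_rightDescent_of_ne_one hv
    rw [CoxeterSystem.isRightDescent_iff] at hi
    have hE' : X.delta E' D = X.delta E D := by
      rw [delta_of_mem_chInterval h', ← he, ← delta_of_mem_chInterval h]
    have key : ∀ A, A ∈ X.chInterval C D → X.delta A D = X.delta E D →
        ∃ F, X.delta D F = cs.simple i ∧ X.delta A F = X.delta E D * cs.simple i ∧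
          X.delta C F = X.delta C D * cs.simple i ∧ A ∈ X.chInterval C F ∧
          cs.length (X.delta C D * cs.simple i) + 1 = cs.length (X.delta C D) := by
      intro A hA hAD
      obtain ⟨F, h1, h2⟩ := X.exists_delta A D i
      rw [hAD] at h2
      have h3 := X.gdist_triangle C A F
      have h4 := X.gdist_triangle C F D
      have h5 : X.gdist F D = 1 := by
        rw [gdist, X.delta_simple_symm h1, cs.length_simple]
      have h6 : X.gdist C A + X.gdist A D = X.gdist C D := hA
      have h7 : X.gdist A F + 1 = X.gdist A D := by rw [gdist, gdist, h2, hAD]; exact hi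
      have h8 : X.gdist C A + X.gdist A F = X.gdist C F := by omega
      have h9 : X.delta C F = X.delta C D * cs.simple i := by
        rw [← X.delta_mul_of_gdist h8, ← X.delta_mul_of_gdist hA, h2, hAD, mul_assoc]
      refine ⟨F, h1, h2, h9, h8, ?_⟩
      rw [← h9]; simp only [gdist] at *; omega
    obtain ⟨F, f1, f2, f3, f4, f5⟩ := key E h rfl
    obtain ⟨F', g1, g2, g3, g4, -⟩ := key E' h' hE'
    have hFF : F = F' := by
      rcases X.delta_mem_pair F D F' i g1 with h1 | h1
      · rw [X.delta_simple_symm f1, cs.simple_mul_simple_self, X.delta_eq_one_iff] at h1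
        exact h1
      · exfalso
        rw [X.delta_simple_symm f1] at h1
        have := X.delta_eq_of_length C F F' i h1 (by
          rw [f3, cs.simple_mul_simple_cancel_right, f5])
        rw [f3, g3, cs.simple_mul_simple_cancel_right] at this
        rw [this] at f5; omega
    refine ih f4 (hFF ▸ g4) ?_
    rw [gdist, f2]
    rw [gdist] at hn; omega

theorem delta_of_mem_chInterval_of_length {C D E E' : X.Chamber} (h : E ∈ X.chInterval C D)
    (h' : E' ∈ X.chInterval C D) {i : B} (he : X.delta C E' = X.delta C E * cs.simple i)
    (hl : cs.length (X.delta C E * cs.simple i) = cs.length (X.delta C E) + 1) :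
    X.delta E E' = cs.simple i := by
  obtain ⟨G, h1, h2⟩ := X.exists_delta C E' i
  rw [he, cs.simple_mul_simple_cancel_right] at h2
  have h3 : G ∈ X.chInterval C D := by
    have h4 := X.gdist_triangle C G D
    have h5 := X.gdist_triangle G E' D
    have h6 : X.gdist G E' = 1 := by rw [gdist, X.delta_simple_symm h1, cs.length_simple]
    have h7 : X.gdist C E' + X.gdist E' D = X.gdist C D := h'
    have h8 : X.gdist C E' = X.gdist C G + 1 := by rw [gdist, gdist, he, h2, hl]
    change X.gdist C G + X.gdist G D = X.gdist C D
    omega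
  rw [eq_of_mem_chInterval h h3 h2.symm]
  exact X.delta_simple_symm h1

theorem delta_eq_simple_of_mem_chInterval {C D E E' : X.Chamber} (h : E ∈ X.chInterval C D)
    (h' : E' ∈ X.chInterval C D) {i : B} (he : X.delta C E' = X.delta C E * cs.simple i) :
    X.delta E E' = cs.simple i := by
  rcases cs.length_mul_simple (X.delta C E) i with hl | hl
  · exact delta_of_mem_chInterval_of_length h h' he hl
  · have he' : X.delta C E = X.delta C E' * cs.simple i := by
      rw [he, cs.simple_mul_simple_cancel_right]
    exact X.delta_simple_symm (delta_of_mem_chInterval_of_length h' h he' (by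
      rw [← he', ← hl, he]))

theorem delta_eq_of_mem_chInterval {C D E E' : X.Chamber} (h : E ∈ X.chInterval C D)
    (h' : E' ∈ X.chInterval C D) :
    X.delta E E' = (X.delta C E)⁻¹ * X.delta C E' := by
  induction hn : cs.length ((X.delta C E)⁻¹ * X.delta C E') generalizing E with
  | zero =>
    rw [cs.length_eq_zero_iff] at hn
    rw [hn, X.delta_eq_one_iff]
    exact eq_of_mem_chInterval h h' (by rw [← mul_one (X.delta C E), ← hn, mul_inv_cancel_left])
  | succ n ih =>
    obtain ⟨i, hi⟩ := cs.exists_leftDescent_of_ne_one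
      (w := (X.delta C E)⁻¹ * X.delta C E') (by intro h1; rw [h1, cs.length_one] at hn; omega)
    rw [CoxeterSystem.isLeftDescent_iff] at hi
    have hz : (X.delta C E * cs.simple i)⁻¹ * X.delta C E' =
        cs.simple i * ((X.delta C E)⁻¹ * X.delta C E') := by
      rw [mul_inv_rev, cs.inv_simple, mul_assoc]
    obtain ⟨F, h1, h2⟩ := exists_mem_chInterval (cs.weak_order_interval_convex
      (z := X.delta C E * cs.simple i) (length_of_mem_chInterval h) (length_of_mem_chInterval h')
      (by rw [hz, inv_mul_cancel_left, cs.length_simple]; omega))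
    have h3 := delta_eq_simple_of_mem_chInterval h h1 h2
    have h4 := ih h1 (by rw [h2, hz]; omega)
    rw [h2, hz] at h4
    have h5 := X.delta_mul_of_length (A := E) (C := F) (D := E') (by
      rw [gdist, gdist, h3, h4, cs.simple_mul_simple_cancel_left, cs.length_simple]; omega)
    rw [h5, h3, h4, cs.simple_mul_simple_cancel_left]

theorem chInterval_subset {C D E E' : X.Chamber} (h : E ∈ X.chInterval C D)
    (h' : E' ∈ X.chInterval C D) : X.chInterval E E' ⊆ X.chInterval C D := by
  intro F hF
  have hEE := delta_eq_of_mem_chInterval h h'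
  have h1 : (X.delta C E)⁻¹ * (X.delta C E * X.delta E F) = X.delta E F :=
    inv_mul_cancel_left _ _
  have h2 : (X.delta C E * X.delta E F)⁻¹ * X.delta C E' = X.delta F E' := by
    rw [delta_of_mem_chInterval hF, hEE, mul_inv_rev, mul_assoc]
  obtain ⟨G, h3, h4⟩ := exists_mem_chInterval (cs.weak_order_interval_convex
    (z := X.delta C E * X.delta E F) (length_of_mem_chInterval h) (length_of_mem_chInterval h')
    (by rw [h1, h2, ← hEE]; exact hF))
  have h5 := delta_eq_of_mem_chInterval h h3
  have h6 := delta_eq_of_mem_chInterval h3 h'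
  rw [h4, h1] at h5
  rw [h4, h2] at h6
  have hG : G ∈ X.chInterval E E' := by
    change cs.length (X.delta E G) + cs.length (X.delta G E') = _
    rw [h5, h6]; exact hF
  rw [eq_of_mem_chInterval hF hG h5.symm]
  exact h3

theorem delta_mem_of_delta_mem {I : Set B} (A : X.Chamber) {C D : X.Chamber}
    (h : X.delta C D ∈ cs.parabolic I) :
    (X.delta A C)⁻¹ * X.delta A D ∈ cs.parabolic I := by
  induction hn : X.gdist C D generalizing D with
  | zero =>
    rw [gdist_eq_zero] at hn
    subst hn
    rw [inv_mul_cancel]; exact one_mem _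
  | succ n ih =>
    obtain ⟨i, hi⟩ := cs.exists_rightDescent_of_ne_one (w := X.delta C D)
      (by intro h1; rw [gdist, h1, cs.length_one] at hn; omega)
    have hiI := cs.simple_mem_parabolic_of_isRightDescent h hi
    rw [CoxeterSystem.isRightDescent_iff] at hi
    obtain ⟨F, h1, h2⟩ := X.exists_delta C D i
    have h3 := ih (D := F) (by rw [h2]; exact mul_mem h hiI) (by
      rw [gdist, h2]; rw [gdist] at hn; omega)
    rcases X.delta_mem_pair A F D i (X.delta_simple_symm h1) with h4 | h4
    · rw [h4, ← mul_assoc]; exact mul_mem h3 hiI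
    · rwa [h4]

theorem mem_residue {I : Set B} {C D : X.Chamber} :
    D ∈ X.residue I C ↔ X.delta C D ∈ cs.parabolic I := Iff.rfl

theorem self_mem_residue (I : Set B) (C : X.Chamber) : C ∈ X.residue I C := by
  rw [mem_residue, delta_self]; exact one_mem _

theorem delta_mem_of_mem_residue {I : Set B} {C D E : X.Chamber} (hD : D ∈ X.residue I C)
    (hE : E ∈ X.residue I C) : X.delta D E ∈ cs.parabolic I := by
  have h1 : X.delta D C ∈ cs.parabolic I := by rw [delta_symm]; exact inv_mem hD
  have h2 := mul_mem h1 (delta_mem_of_delta_mem D (C := C) (D := E) hE)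
  rwa [mul_inv_cancel_left] at h2

theorem residue_eq_of_mem {I : Set B} {C D : X.Chamber} (h : D ∈ X.residue I C) :
    X.residue I C = X.residue I D := by
  have h' : C ∈ X.residue I D := by rw [mem_residue, delta_symm]; exact inv_mem h
  ext E
  exact ⟨fun hE => delta_mem_of_mem_residue h hE, fun hE => delta_mem_of_mem_residue h' hE⟩

theorem exists_mem_residue_delta {I : Set B} (C D : X.Chamber) {v : W}
    (hv : v ∈ cs.parabolic I) : ∃ E ∈ X.residue I D, X.delta C E = X.delta C D * v := by
  have step : ∀ (u : W) (i : B), i ∈ I → (∃ E ∈ X.residue I D, X.delta C E = X.delta C D * u) →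
      ∃ E ∈ X.residue I D, X.delta C E = X.delta C D * (u * cs.simple i) := by
    rintro u i hi ⟨E, hE, h1⟩
    obtain ⟨F, h2, h3⟩ := X.exists_delta C E i
    refine ⟨F, ?_, by rw [h3, h1, mul_assoc]⟩
    rw [residue_eq_of_mem hE, mem_residue, h2]
    exact Subgroup.subset_closure ⟨i, hi, rfl⟩
  induction hv using Subgroup.closure_induction_right with
  | one => exact ⟨D, self_mem_residue I D, (mul_one _).symm⟩
  | mul_right u hu y hy ih =>
    obtain ⟨i, hi, rfl⟩ := hy
    exact step u i hi ih
  | mul_inv_cancel u hu y hy ih =>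
    obtain ⟨i, hi, rfl⟩ := hy
    rw [cs.inv_simple]
    exact step u i hi ih

variable (X) in
/-- `D` is a gate of `C` on the set of chambers `R`. -/
def IsGate (R : Set X.Chamber) (C D : X.Chamber) : Prop :=
  D ∈ R ∧ ∀ E ∈ R, X.gdist C E = X.gdist C D + X.gdist D E

theorem IsGate.unique {R : Set X.Chamber} {C D D' : X.Chamber} (h : X.IsGate R C D)
    (h' : X.IsGate R C D') : D = D' := by
  have h1 := h.2 D' h'.1
  have h2 := h'.2 D h.1
  rw [← X.gdist_eq_zero]; omega

theorem IsGate.gate_eq {R : Set X.Chamber} {C D : X.Chamber} (h : X.IsGate R C D) :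
    X.gate R C = D :=
  IsGate.unique (Classical.epsilon_spec (p := fun D => X.IsGate R C D) ⟨D, h⟩) h

theorem isGate_of_length {I : Set B} {C D : X.Chamber}
    (h : ∀ v ∈ cs.parabolic I,
      cs.length (X.delta C D * v) = cs.length (X.delta C D) + cs.length v) :
    X.IsGate (X.residue I D) C D := by
  refine ⟨self_mem_residue I D, fun E hE => ?_⟩
  have h1 := h _ hE
  rw [gdist, X.delta_mul_of_length h1, h1]; rfl

theorem length_mul_of_minimal {I : Set B} {C D : X.Chamber}
    (h : ∀ E ∈ X.residue I D, X.gdist C D ≤ X.gdist C E) {v : W} (hv : v ∈ cs.parabolic I) :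
    cs.length (X.delta C D * v) = cs.length (X.delta C D) + cs.length v := by
  refine cs.length_mul_of_minimal (fun u hu => ?_) hv
  obtain ⟨E, h1, h2⟩ := exists_mem_residue_delta C D hu
  rw [← h2]; exact h E h1

theorem IsGate.length_mul {I : Set B} {C D : X.Chamber} (h : X.IsGate (X.residue I D) C D)
    {v : W} (hv : v ∈ cs.parabolic I) :
    cs.length (X.delta C D * v) = cs.length (X.delta C D) + cs.length v :=
  length_mul_of_minimal (fun E hE => by rw [h.2 E hE]; omega) hv

theorem isGate_gate (I : Set B) (C D : X.Chamber) :
    X.IsGate (X.residue I D) C (X.gate (X.residue I D) C) := by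
  obtain ⟨F, hF⟩ := WellFounded.has_min (measure fun E : X.Chamber => X.gdist C E).wf
    (X.residue I D) ⟨D, self_mem_residue I D⟩
  have h1 := residue_eq_of_mem hF.1
  have h2 : X.IsGate (X.residue I D) C F := by
    rw [h1]
    refine isGate_of_length fun v hv => length_mul_of_minimal (fun E hE => ?_) hv
    exact not_lt.1 (hF.2 E (h1 ▸ hE))
  rw [h2.gate_eq]; exact h2

theorem IsGate.mem_chInterval {R : Set X.Chamber} {C D E : X.Chamber} (h : X.IsGate R C D)
    (hE : E ∈ R) : D ∈ X.chInterval C E := (h.2 E hE).symm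

theorem projSet_residue (I J : Set B) (C₀ D₀ : X.Chamber) :
    ∃ (C : X.Chamber) (w : W), C ∈ X.residue I C₀ ∧
      X.projSet (X.residue I C₀) (X.residue J D₀) = X.residue (cs.interType I J w) C := by
  obtain ⟨⟨C, D⟩, ⟨hC, hD⟩, hmin⟩ :=
    WellFounded.has_min (measure fun p : X.Chamber × X.Chamber => X.gdist p.1 p.2).wf
      (X.residue I C₀ ×ˢ X.residue J D₀)
      ⟨(C₀, D₀), self_mem_residue I C₀, self_mem_residue J D₀⟩
  simp only at hC hD
  rw [residue_eq_of_mem hC, residue_eq_of_mem hD]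
  refine ⟨C, X.delta C D, self_mem_residue I C, ?_⟩
  have hmin' : ∀ E ∈ X.residue I C, ∀ F ∈ X.residue J D, X.gdist C D ≤ X.gdist E F :=
    fun E hE F hF => not_lt.1 (hmin (E, F)
      ⟨(residue_eq_of_mem hC).symm ▸ hE, (residue_eq_of_mem hD).symm ▸ hF⟩)
  have hJ : ∀ v ∈ cs.parabolic J,
      cs.length (X.delta C D * v) = cs.length (X.delta C D) + cs.length v :=
    fun v hv => length_mul_of_minimal (hmin' C (self_mem_residue I C)) hv
  have hI : ∀ v ∈ cs.parabolic I,
      cs.length ((X.delta C D)⁻¹ * v) = cs.length (X.delta C D)⁻¹ + cs.length v := by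
    rw [← X.delta_symm]
    intro v hv
    refine length_mul_of_minimal (fun E hE => ?_) hv
    rw [X.gdist_symm C D, X.gdist_symm E D]
    exact hmin' E hE D (self_mem_residue J D)
  have hI' : ∀ v ∈ cs.parabolic I,
      cs.length (v * X.delta C D) = cs.length v + cs.length (X.delta C D) := by
    intro v hv
    have := hI v⁻¹ (inv_mem hv)
    rwa [← mul_inv_rev, cs.length_inv, cs.length_inv, cs.length_inv, add_comm] at this
  ext E
  constructor
  · rintro ⟨F, hF, rfl⟩
    have hg := isGate_gate I F C
    set E := X.gate (X.residue I C) F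
    have h1 : X.delta C F = X.delta C D * X.delta D F := X.delta_mul_of_length (hJ _ hF)
    have h2 : X.gdist C E + X.gdist E F = X.gdist C F := by
      rw [X.gdist_symm F C, hg.2 C (self_mem_residue I C), X.gdist_symm F E, X.gdist_symm C E,
        add_comm]
    have h3 := X.delta_mul_of_gdist h2
    exact cs.mem_parabolic_interType hI' hg.1 hF (h3.trans h1) (by rw [h3]; exact h2.symm)
  · intro hE
    have hEI : E ∈ X.residue I C := cs.parabolic_interType_le I J _ hE
    have h1 : X.IsGate (X.residue I C) D C := isGate_of_length fun v hv => by
      rw [X.delta_symm]; exact hI v hv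
    have h2 : X.delta E D = X.delta C D *
        ((X.delta C D)⁻¹ * (X.delta C E)⁻¹ * X.delta C D) := by
      have := X.delta_mul_of_gdist (h1.2 E hEI).symm
      rw [X.delta_symm D E, ← this, X.delta_symm C D]; group
    have h3 : (X.delta C D)⁻¹ * (X.delta C E)⁻¹ * X.delta C D ∈ cs.parabolic J :=
      cs.conj_mem_of_mem_interType (inv_mem hE)
    set j := (X.delta C D)⁻¹ * (X.delta C E)⁻¹ * X.delta C D
    have hg := isGate_gate J E D
    set F := X.gate (X.residue J D) E
    have h4 := X.delta_mul_of_gdist (hg.2 D (self_mem_residue J D)).symm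
    have h5 : X.delta F D ∈ cs.parabolic J :=
      delta_mem_of_mem_residue hg.1 (self_mem_residue J D)
    have hgF := hg
    rw [residue_eq_of_mem hg.1] at hgF
    have h6 : X.delta E F = X.delta C D * (j * (X.delta F D)⁻¹) := by
      rw [← mul_assoc, ← h2, ← h4, mul_inv_cancel_right]
    have h7 : X.delta C D = X.delta E F * (X.delta F D * j⁻¹) := by
      rw [h6]; group
    have h8 := hJ _ (mul_mem h3 (inv_mem h5))
    have h9 := hgF.length_mul (mul_mem h5 (inv_mem h3))
    rw [← h6] at h8
    rw [← h7] at h9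
    have h10 : j * (X.delta F D)⁻¹ = 1 := by rw [← cs.length_eq_zero_iff]; omega
    rw [h10, mul_one] at h6
    refine ⟨F, hg.1, IsGate.gate_eq ?_⟩
    rw [residue_eq_of_mem hEI]
    refine isGate_of_length fun v hv => ?_
    rw [X.delta_symm E F, h6]
    exact hI v hv

theorem projRes_coe (R T : X.Res) : (X.projRes R T).1 = X.projSet R.1 T.1 := by
  obtain ⟨I, C₀, hI, hR⟩ := R.2
  obtain ⟨J, D₀, hJ, hT⟩ := T.2
  obtain ⟨C, w, hC, h⟩ := projSet_residue I J C₀ D₀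
  refine Classical.epsilon_spec (p := fun U : X.Res => U.1 = X.projSet R.1 T.1)
    ⟨⟨X.residue (cs.interType I J w) C, _, C, ?_, rfl⟩, ?_⟩
  · exact hI.subset (cs.parabolic_interType_le I J w)
  · rw [hR, hT, h]

theorem isGate_gate_res (R : X.Res) (C : X.Chamber) : X.IsGate R.1 C (X.gate R.1 C) := by
  obtain ⟨I, C₀, hI, hR⟩ := R.2
  rw [hR]; exact isGate_gate I C C₀

theorem leRes_projRes (R T : X.Res) : X.leRes R (X.projRes R T) := by
  intro C hC
  rw [projRes_coe] at hC
  obtain ⟨D, -, rfl⟩ := hC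
  exact (isGate_gate_res R D).1

theorem projRes_mem_conv2 (R T : X.Res) : X.projRes R T ∈ X.conv2 R T := by
  rintro 𝓢 ⟨h𝓢, hsub⟩
  exact h𝓢.2 R (hsub (by simp)) T (hsub (by simp))

theorem convexResSet_meets_chInterval (C D : X.Chamber) :
    X.ConvexResSet {R | (R.1 ∩ X.chInterval C D).Nonempty} := by
  refine ⟨fun R₁ R₂ h ⟨E, h1, h2⟩ => ⟨E, h h1, h2⟩, ?_⟩
  rintro R₁ ⟨E₁, h1, h2⟩ R₂ ⟨E₂, h3, h4⟩
  refine ⟨X.gate R₁.1 E₂, ?_, ?_⟩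
  · rw [projRes_coe]; exact ⟨E₂, h3, rfl⟩
  · exact chInterval_subset h4 h2 ((isGate_gate_res R₁ E₂).mem_chInterval h1)

theorem left_mem_chInterval (C D : X.Chamber) : C ∈ X.chInterval C D := by
  change X.gdist C C + _ = _
  rw [X.gdist_eq_zero.2 rfl, zero_add]

theorem right_mem_chInterval (C D : X.Chamber) : D ∈ X.chInterval C D := by
  change _ + X.gdist D D = _
  rw [X.gdist_eq_zero.2 rfl, add_zero]

theorem leRes_projRes_of_mem_conv2 {x R σ : X.Res} (hσ : σ ∈ X.conv2 x R)
    (hx : X.leRes x σ) : X.leRes σ (X.projRes x R) := by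
  intro C hC
  rw [projRes_coe] at hC
  obtain ⟨D, hD, rfl⟩ := hC
  have hg := isGate_gate_res x D
  set C := X.gate x.1 D
  obtain ⟨E, h1, h2⟩ := hσ _ ⟨convexResSet_meets_chInterval C D, by
    rintro S (rfl | rfl)
    · exact ⟨C, hg.1, left_mem_chInterval C D⟩
    · exact ⟨D, hD, right_mem_chInterval C D⟩⟩
  have h3 := hg.2 E (hx h1)
  have h4 : X.gdist C E + X.gdist E D = X.gdist C D := h2
  rw [X.gdist_symm E D, X.gdist_symm C D] at h3
  have h5 : C = E := X.gdist_eq_zero.1 (by omega)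
  rwa [h5]

theorem ConvSeq.eventually_projRes_eq {ξ : X.Res → X.Res} {R : ℕ → X.Res}
    (h : X.ConvSeq ξ R) (x : X.Res) : ∀ᶠ n in atTop, X.projRes x (R n) = ξ x := by
  have h1 := (tendsto_pi_nhds.1 h) x
  rw [nhds_discrete, tendsto_pure] at h1
  exact h1

end Bldg

/-- for `x ∈ Res(X)` and `ξ ∈ Cr(X)`, the projection `proj_x(ξ) = ξ(x)`
is the unique maximal residue containing `x` and contained in the sector `Q(x,ξ)`. -/
theorem statement9 {cs : CoxeterSystem M W} (X : Bldg cs)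
    (ξ : X.Res → X.Res) (hξ : ξ ∈ X.Cr) (hseq : ∃ R : ℕ → X.Res, X.ConvSeq ξ R)
    (x : X.Res) :
    ξ x ∈ X.Qsector x ξ ∧ X.leRes x (ξ x) ∧
    ∀ σ ∈ X.Qsector x ξ, X.leRes x σ → X.leRes σ (ξ x) := by
  have hR := Classical.epsilon_spec hseq
  have hev := hR.eventually_projRes_eq x
  obtain ⟨N, hN⟩ := eventually_atTop.1 hev
  refine ⟨?_, hN N le_rfl ▸ Bldg.leRes_projRes x _, fun σ hσ hx => ?_⟩
  · refine Set.mem_iUnion.2 ⟨N, Set.mem_iInter₂.2 fun n hn => ?_⟩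
    rw [← hN n hn]
    exact Bldg.projRes_mem_conv2 x _
  · obtain ⟨k, hk⟩ := Set.mem_iUnion.1 hσ
    have h1 := Set.mem_iInter₂.1 hk (max k N) (le_max_left k N)
    rw [← hN _ (le_max_right k N)]
    exact Bldg.leRes_projRes_of_mem_conv2 h1 hx
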